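/- arXiv:1802.08227 — 5 statements merged into one kernel-verified Lean document; each statement's English description precedes it below -/
import Mathlib

section
/- Let T be a positive integer and let δ ∈ ℝ satisfy sin((δ+π)/(2T)) ≠ 0 and sin((δ−π)/(2T)) ≠ 0. Then the phase-estimation amplitude admits the closed form (√2/T) · Σ_{τ=0}^{T−1} exp(i δ τ / T) · sin(π(τ + 1/2)/T) = − exp(i (δ/2)(1 − 1/T)) · (√2 cos(δ/2)/T) · (cos(δ/(2T)) sin(π/(2T))) / (sin((δ+π)/(2T)) · sin((δ−π)/(2T))). -/
open Complex Real

theorem geom_aux (a : ℂ) (n : ℕ) :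
    (∑ τ ∈ Finset.range n, Complex.exp (2 * a * I * τ)) * (Complex.exp (a * I) * Complex.sin a) =
      (1 - Complex.exp (2 * a * I * n)) * I / 2 := by
  have h : Complex.exp (a * I) * Complex.sin a = (1 - Complex.exp (2 * a * I)) * I / 2 := by
    have e1 : Complex.exp (a * I) * Complex.exp (-a * I) = 1 := by
      rw [← Complex.exp_add]; simp
    have e2 : Complex.exp (2 * a * I) = Complex.exp (a * I) * Complex.exp (a * I) := by
      rw [← Complex.exp_add]; congr 1; ring
    rw [Complex.sin, e2]
    linear_combination (I / 2) * e1
  rw [h]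
  induction n with
  | zero => simp
  | succ n ih =>
    have e : Complex.exp (2 * a * I * ((n + 1 : ℕ) : ℂ)) =
        Complex.exp (2 * a * I * n) * Complex.exp (2 * a * I) := by
      rw [← Complex.exp_add]; congr 1; push_cast; ring
    rw [Finset.sum_range_succ, e]
    linear_combination ih

theorem sum_aux (T : ℕ) (d p : ℂ) (hp : 2 * p * T = Real.pi)
    (ha : Complex.sin (d + p) ≠ 0) (hb : Complex.sin (d - p) ≠ 0) :
    ∑ τ ∈ Finset.range T, Complex.exp (2 * d * I * τ) * Complex.sin (p * (2 * τ + 1)) =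
      -Complex.exp (I * (d * T - d)) * Complex.cos (d * T) *
        (Complex.cos d * Complex.sin p) / (Complex.sin (d + p) * Complex.sin (d - p)) := by
  have ga := geom_aux (d + p) T
  have gb := geom_aux (d - p) T
  have ea : Complex.exp (2 * (d + p) * I * T) = -Complex.exp (2 * d * T * I) := by
    rw [show 2 * (d + p) * I * T = 2 * d * T * I + Real.pi * I by rw [← hp]; ring,
      Complex.exp_add, Complex.exp_pi_mul_I]; ring
  have eb : Complex.exp (2 * (d - p) * I * T) = -Complex.exp (2 * d * T * I) := by
    rw [show 2 * (d - p) * I * T = 2 * d * T * I - Real.pi * I by rw [← hp]; ring,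
      Complex.exp_sub, Complex.exp_pi_mul_I]; ring
  rw [ea] at ga
  rw [eb] at gb
  have hs : ∑ τ ∈ Finset.range T, Complex.exp (2 * d * I * τ) * Complex.sin (p * (2 * τ + 1)) =
      (Complex.exp (-p * I) * (∑ τ ∈ Finset.range T, Complex.exp (2 * (d - p) * I * τ)) -
       Complex.exp (p * I) * (∑ τ ∈ Finset.range T, Complex.exp (2 * (d + p) * I * τ))) * I / 2 := by
    rw [Finset.mul_sum, Finset.mul_sum, ← Finset.sum_sub_distrib, Finset.sum_mul, Finset.sum_div]
    refine Finset.sum_congr rfl fun τ _ => ?_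
    rw [← Complex.exp_add, ← Complex.exp_add, Complex.sin, mul_div_assoc', ← mul_assoc, mul_sub,
      ← Complex.exp_add, ← Complex.exp_add]
    congr 4 <;> ring
  rw [hs]
  have hc : Complex.exp (I * (d * T - d)) * Complex.cos (d * T) =
      (1 + Complex.exp (2 * d * T * I)) * Complex.exp (-d * I) / 2 := by
    rw [Complex.cos, mul_div_assoc', mul_add, ← Complex.exp_add, ← Complex.exp_add, add_mul,
      ← Complex.exp_add, one_mul, add_comm]
    congr 3 <;> ring
  have hss : Complex.sin (d + p) - Complex.sin (d - p) = 2 * (Complex.cos d * Complex.sin p) := by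
    rw [Complex.sin_add, Complex.sin_sub]; ring
  have xa : Complex.exp (p * I) = Complex.exp ((d + p) * I) * Complex.exp (-d * I) := by
    rw [← Complex.exp_add]; congr 1; ring
  have xb : Complex.exp (-p * I) = Complex.exp ((d - p) * I) * Complex.exp (-d * I) := by
    rw [← Complex.exp_add]; congr 1; ring
  rw [eq_div_iff (mul_ne_zero ha hb), neg_mul (Complex.exp (I * (d * T - d))), hc, xa, xb]
  linear_combination (I / 2 * Complex.exp (-d * I) * Complex.sin (d + p)) * gb
    - (I / 2 * Complex.exp (-d * I) * Complex.sin (d - p)) * ga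
    - (1 + Complex.exp (2 * d * T * I)) * Complex.exp (-d * I) / 4 * hss
    + (1 + Complex.exp (2 * d * T * I)) * Complex.exp (-d * I) / 4 *
      (Complex.sin (d + p) - Complex.sin (d - p)) * Complex.I_sq

/-- exact closed form of the phase-estimation amplitude. -/
theorem phase_estimation_amplitude_closed_form (T : ℕ) (hT : 0 < T) (δ : ℝ)
    (h₁ : Real.sin ((δ + Real.pi) / (2 * T)) ≠ 0)
    (h₂ : Real.sin ((δ - Real.pi) / (2 * T)) ≠ 0) :
    ((Real.sqrt 2 : ℂ) / (T : ℂ)) *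
        ∑ τ ∈ Finset.range T,
          Complex.exp (Complex.I * (δ : ℂ) * (τ : ℂ) / (T : ℂ)) *
            (Real.sin (Real.pi * ((τ : ℝ) + 1 / 2) / T) : ℂ) =
      -Complex.exp (Complex.I * ((δ : ℂ) / 2) * (1 - 1 / (T : ℂ))) *
        ((Real.sqrt 2 : ℂ) * (Real.cos (δ / 2) : ℂ) / (T : ℂ)) *
          ((Real.cos (δ / (2 * T)) : ℂ) * (Real.sin (Real.pi / (2 * T)) : ℂ)) /
            ((Real.sin ((δ + Real.pi) / (2 * T)) : ℂ) *
              (Real.sin ((δ - Real.pi) / (2 * T)) : ℂ)) := by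
  have hT' : (T : ℂ) ≠ 0 := by exact_mod_cast hT.ne'
  have h₁' := Complex.ofReal_ne_zero.mpr h₁
  have h₂' := Complex.ofReal_ne_zero.mpr h₂
  push_cast at h₁' h₂' ⊢
  have key := sum_aux T ((δ : ℂ) / (2 * T)) ((Real.pi : ℂ) / (2 * T)) (by field_simp)
    (by rw [← add_div]; exact h₁') (by rw [← sub_div]; exact h₂')
  rw [← add_div, ← sub_div] at key
  have e1 : (δ : ℂ) / (2 * T) * T = δ / 2 := by field_simp
  have e2 : I * ((δ : ℂ) / 2 - δ / (2 * T)) = I * ((δ : ℂ) / 2) * (1 - 1 / (T : ℂ)) := by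
    field_simp
  rw [e1, e2] at key
  have hs : ∑ τ ∈ Finset.range T, Complex.exp (I * (δ : ℂ) * (τ : ℂ) / (T : ℂ)) *
      Complex.sin (Real.pi * ((τ : ℂ) + 1 / 2) / T) =
      ∑ τ ∈ Finset.range T, Complex.exp (2 * ((δ : ℂ) / (2 * T)) * I * τ) *
        Complex.sin ((Real.pi : ℂ) / (2 * T) * (2 * τ + 1)) := by
    refine Finset.sum_congr rfl fun τ _ => ?_
    congr 2 <;> field_simp
  rw [hs, key]
  ring
end

section
/- There exists a constant c > 0 such that for every real κ ≥ 1 and all λ_1, λ_2 ∈ (0, ∞), ‖h(λ_1) − h(λ_2)‖ ≤ c · κ · |λ_1 − λ_2|; that is, the map λ ↦ h(λ) built from the filter functions is O(κ)-Lipschitz. -/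
/-- The HHL filter function `f` (with `κ' = 2κ`). -/
noncomputable def hhlF (κ lam : ℝ) : ℝ :=
  if 1 / κ ≤ lam then 1 / (2 * κ * lam)
  else if 1 / (2 * κ) < lam then
    (1 / 2) * Real.sin ((Real.pi / 2) * (lam - 1 / (2 * κ)) / (1 / κ - 1 / (2 * κ)))
  else 0

/-- The HHL filter function `g` (with `κ' = 2κ`). -/
noncomputable def hhlG (κ lam : ℝ) : ℝ :=
  if 1 / κ ≤ lam then 0
  else if 1 / (2 * κ) < lam then
    (1 / 2) * Real.cos ((Real.pi / 2) * (lam - 1 / (2 * κ)) / (1 / κ - 1 / (2 * κ)))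
  else 1 / 2

/-- The map `λ ↦ h(λ) = (√(1 − f(λ)² − g(λ)²), f(λ), g(λ)) ∈ ℝ³`. -/
noncomputable def hhlH (κ lam : ℝ) : EuclideanSpace ℝ (Fin 3) :=
  (WithLp.equiv 2 (Fin 3 → ℝ)).symm
    ![Real.sqrt (1 - hhlF κ lam ^ 2 - hhlG κ lam ^ 2), hhlF κ lam, hhlG κ lam]

/-- clamped angle -/
noncomputable def hhlT (x : ℝ) : ℝ := Real.pi / 2 * max 0 (min 1 (2 * x - 1))

lemma hhlF_eq (κ lam : ℝ) (hκ : 1 ≤ κ) :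
    hhlF κ lam = 1 / 2 * Real.sin (hhlT (κ * lam)) * (1 / max 1 (κ * lam)) := by
  have h0 : 0 < κ := by linarith
  unfold hhlF hhlT
  split_ifs with h1 h2
  · have : 1 ≤ κ * lam := by rw [div_le_iff₀ h0] at h1; linarith
    rw [min_eq_left (by linarith), max_eq_right (by norm_num), max_eq_right this]
    have : lam ≠ 0 := by rintro rfl; simp at this; linarith
    simp
    field_simp
  · have a : κ * lam < 1 := by rw [not_le, lt_div_iff₀ h0] at h1; linarith
    have b : 1 < 2 * (κ * lam) := by rw [div_lt_iff₀ (by linarith)] at h2; linarith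
    rw [min_eq_right (by linarith), max_eq_right (by linarith), max_eq_left (by linarith)]
    have : (Real.pi / 2) * (lam - 1 / (2 * κ)) / (1 / κ - 1 / (2 * κ))
        = Real.pi / 2 * (2 * (κ * lam) - 1) := by
      have : 1 / κ - 1 / (2 * κ) = 1 / (2 * κ) := by field_simp; norm_num
      rw [this]; field_simp
    rw [this]; ring
  · have b : 2 * (κ * lam) ≤ 1 := by
      rw [not_lt, le_div_iff₀ (by linarith)] at h2; linarith
    rw [min_eq_right (by linarith), max_eq_left (by linarith)]
    simp

lemma hhlG_eq (κ lam : ℝ) (hκ : 1 ≤ κ) :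
    hhlG κ lam = 1 / 2 * Real.cos (hhlT (κ * lam)) := by
  have h0 : 0 < κ := by linarith
  unfold hhlG hhlT
  split_ifs with h1 h2
  · have : 1 ≤ κ * lam := by rw [div_le_iff₀ h0] at h1; linarith
    rw [min_eq_left (by linarith), max_eq_right (by norm_num)]
    simp
  · have a : κ * lam < 1 := by rw [not_le, lt_div_iff₀ h0] at h1; linarith
    have b : 1 < 2 * (κ * lam) := by rw [div_lt_iff₀ (by linarith)] at h2; linarith
    rw [min_eq_right (by linarith), max_eq_right (by linarith)]
    have : (Real.pi / 2) * (lam - 1 / (2 * κ)) / (1 / κ - 1 / (2 * κ))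
        = Real.pi / 2 * (2 * (κ * lam) - 1) := by
      have : 1 / κ - 1 / (2 * κ) = 1 / (2 * κ) := by field_simp; norm_num
      rw [this]; field_simp
    rw [this]
  · have b : 2 * (κ * lam) ≤ 1 := by
      rw [not_lt, le_div_iff₀ (by linarith)] at h2; linarith
    rw [min_eq_right (by linarith), max_eq_left (by linarith)]
    simp

lemma hhlT_lip (x y : ℝ) : |hhlT x - hhlT y| ≤ 4 * |x - y| := by
  unfold hhlT
  have h : |max 0 (min 1 (2 * x - 1)) - max 0 (min 1 (2 * y - 1))| ≤ 2 * |x - y| := by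
    calc _ ≤ |min 1 (2 * x - 1) - min 1 (2 * y - 1)| := by
          simpa using abs_max_sub_max_le_max (0:ℝ) (min 1 (2 * x - 1)) 0 (min 1 (2 * y - 1))
      _ ≤ |(2 * x - 1) - (2 * y - 1)| := by
          simpa using abs_min_sub_min_le_max (1:ℝ) (2 * x - 1) 1 (2 * y - 1)
      _ = 2 * |x - y| := by
          rw [show (2 * x - 1) - (2 * y - 1) = 2 * (x - y) by ring, abs_mul]; norm_num
  rw [← mul_sub, abs_mul, abs_of_pos (by positivity)]
  have := Real.pi_le_four
  have := abs_nonneg (x - y)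
  have := Real.pi_pos
  nlinarith [abs_nonneg (max 0 (min 1 (2 * x - 1)) - max 0 (min 1 (2 * y - 1)))]

lemma hhlInv_lip (x y : ℝ) : |1 / max 1 x - 1 / max 1 y| ≤ |x - y| := by
  have hm : |max 1 x - max 1 y| ≤ |x - y| := by
    simpa using abs_max_sub_max_le_max (1:ℝ) x 1 y
  have hx := le_max_left 1 x
  have hy := le_max_left 1 y
  generalize max 1 x = a at *
  generalize max 1 y = b at *
  have : 1 / a - 1 / b = (b - a) / (a * b) := by
    field_simp
  rw [this, abs_div, abs_sub_comm b a, abs_of_pos (by positivity : 0 < a * b)]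
  exact (div_le_self (abs_nonneg _) (by nlinarith)).trans hm

lemma hhl_sin_lip (a b : ℝ) : |Real.sin a - Real.sin b| ≤ |a - b| := by
  simpa [Real.dist_eq] using Real.lipschitzWith_sin.dist_le_mul a b

lemma hhl_cos_lip (a b : ℝ) : |Real.cos a - Real.cos b| ≤ |a - b| := by
  simpa [Real.dist_eq] using Real.lipschitzWith_cos.dist_le_mul a b

lemma hhlF_lip (κ a b : ℝ) (hκ : 1 ≤ κ) :
    |hhlF κ a - hhlF κ b| ≤ 5 / 2 * |κ * a - κ * b| := by
  rw [hhlF_eq κ a hκ, hhlF_eq κ b hκ]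
  have h1 := (hhl_sin_lip _ _).trans (hhlT_lip (κ * a) (κ * b))
  have h2 := hhlInv_lip (κ * a) (κ * b)
  have h3 := Real.abs_sin_le_one (hhlT (κ * b))
  have h4 : |1 / max 1 (κ * a)| ≤ 1 := by
    have := le_max_left 1 (κ * a)
    rw [abs_of_pos (by positivity)]
    exact (div_le_one (by positivity)).2 this
  generalize Real.sin (hhlT (κ * a)) = s at *
  generalize Real.sin (hhlT (κ * b)) = t at *
  generalize 1 / max 1 (κ * a) = u at *
  generalize 1 / max 1 (κ * b) = v at *
  have e : 1 / 2 * s * u - 1 / 2 * t * v = 1 / 2 * ((s - t) * u + t * (u - v)) := by ring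
  rw [e, abs_mul, abs_of_pos (by norm_num : (0:ℝ) < 1 / 2)]
  have h5 := abs_add_le ((s - t) * u) (t * (u - v))
  rw [abs_mul, abs_mul] at h5
  have h6 := mul_le_mul h1 h4 (abs_nonneg _) (by positivity)
  have h7 := mul_le_mul h3 h2 (abs_nonneg _) (by positivity)
  linarith

lemma hhlG_lip (κ a b : ℝ) (hκ : 1 ≤ κ) :
    |hhlG κ a - hhlG κ b| ≤ 2 * |κ * a - κ * b| := by
  rw [hhlG_eq κ a hκ, hhlG_eq κ b hκ, ← mul_sub, abs_mul,
    abs_of_pos (by norm_num : (0:ℝ) < 1 / 2)]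
  have h1 := (hhl_cos_lip _ _).trans (hhlT_lip (κ * a) (κ * b))
  linarith

lemma hhl_sq_le (κ a : ℝ) (hκ : 1 ≤ κ) : hhlF κ a ^ 2 + hhlG κ a ^ 2 ≤ 1 / 4 := by
  rw [hhlF_eq κ a hκ, hhlG_eq κ a hκ]
  have h := Real.sin_sq_add_cos_sq (hhlT (κ * a))
  have h0 : 0 ≤ 1 / max 1 (κ * a) := by positivity
  have h4 : 1 / max 1 (κ * a) ≤ 1 := by
    have := le_max_left 1 (κ * a)
    exact (div_le_one (by positivity)).2 this
  generalize 1 / max 1 (κ * a) = u at *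
  have hu : u ^ 2 ≤ 1 := by nlinarith
  have := mul_le_mul_of_nonneg_left hu (sq_nonneg (Real.sin (hhlT (κ * a))))
  nlinarith

lemma hhl_sqrt_lip (f g f' g' : ℝ) (h : f ^ 2 + g ^ 2 ≤ 1 / 4) (h' : f' ^ 2 + g' ^ 2 ≤ 1 / 4) :
    |Real.sqrt (1 - f ^ 2 - g ^ 2) - Real.sqrt (1 - f' ^ 2 - g' ^ 2)|
      ≤ |f - f'| + |g - g'| := by
  have r1 := Real.sq_sqrt (show 0 ≤ 1 - f ^ 2 - g ^ 2 by linarith)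
  have r2 := Real.sq_sqrt (show 0 ≤ 1 - f' ^ 2 - g' ^ 2 by linarith)
  have q1 : 1 / 2 ≤ Real.sqrt (1 - f ^ 2 - g ^ 2) := Real.le_sqrt_of_sq_le (by linarith)
  have q2 : 1 / 2 ≤ Real.sqrt (1 - f' ^ 2 - g' ^ 2) := Real.le_sqrt_of_sq_le (by linarith)
  generalize Real.sqrt (1 - f ^ 2 - g ^ 2) = r at *
  generalize Real.sqrt (1 - f' ^ 2 - g' ^ 2) = r' at *
  have bf : |f' + f| ≤ 1 :=
    (sq_le_one_iff_abs_le_one _).1 (by nlinarith [sq_nonneg (f' - f), sq_nonneg f, sq_nonneg g, sq_nonneg f', sq_nonneg g'])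
  have bg : |g' + g| ≤ 1 :=
    (sq_le_one_iff_abs_le_one _).1 (by nlinarith [sq_nonneg (g' - g), sq_nonneg f, sq_nonneg g, sq_nonneg f', sq_nonneg g'])
  have e : (r - r') * (r + r') = -((f - f') * (f' + f) + (g - g') * (g' + g)) := by
    linear_combination r1 - r2
  have e2 : |r - r'| * (r + r') = |(f - f') * (f' + f) + (g - g') * (g' + g)| := by
    rw [← abs_neg (_ + _), ← e, abs_mul, abs_of_nonneg (by linarith : 0 ≤ r + r')]
  have h5 := abs_add_le ((f - f') * (f' + f)) ((g - g') * (g' + g))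
  rw [abs_mul, abs_mul] at h5
  have h6 := mul_le_mul_of_nonneg_left bf (abs_nonneg (f - f'))
  have h7 := mul_le_mul_of_nonneg_left bg (abs_nonneg (g - g'))
  have h8 := mul_le_mul_of_nonneg_left (show 1 ≤ r + r' by linarith) (abs_nonneg (r - r'))
  linarith

/-- the map `λ ↦ h(λ)` is `O(κ)`-Lipschitz. -/
theorem filter_function_lipschitz :
    ∃ c : ℝ, 0 < c ∧ ∀ κ : ℝ, 1 ≤ κ → ∀ lam₁ lam₂ : ℝ, 0 < lam₁ → 0 < lam₂ →
      ‖hhlH κ lam₁ - hhlH κ lam₂‖ ≤ c * κ * |lam₁ - lam₂| := by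
  refine ⟨9, by norm_num, fun κ hκ a b _ _ => ?_⟩
  have hF := hhlF_lip κ a b hκ
  have hG := hhlG_lip κ a b hκ
  have hS := hhl_sqrt_lip _ _ _ _ (hhl_sq_le κ a hκ) (hhl_sq_le κ b hκ)
  have hd : |κ * a - κ * b| = κ * |a - b| := by
    rw [← mul_sub, abs_mul, abs_of_pos (by linarith)]
  rw [hd] at hF hG
  rw [EuclideanSpace.norm_eq, Fin.sum_univ_three]
  simp only [hhlH, Real.norm_eq_abs]
  simp
  generalize Real.sqrt (1 - hhlF κ a ^ 2 - hhlG κ a ^ 2)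
    - Real.sqrt (1 - hhlF κ b ^ 2 - hhlG κ b ^ 2) = p at *
  generalize hhlF κ a - hhlF κ b = q at *
  generalize hhlG κ a - hhlG κ b = r at *
  have : Real.sqrt (p ^ 2 + q ^ 2 + r ^ 2) ≤ |p| + |q| + |r| := by
    apply Real.sqrt_le_iff.2 ⟨by positivity, ?_⟩
    rw [← sq_abs p, ← sq_abs q, ← sq_abs r]
    have := mul_nonneg (abs_nonneg p) (abs_nonneg q)
    have := mul_nonneg (abs_nonneg p) (abs_nonneg r)
    have := mul_nonneg (abs_nonneg q) (abs_nonneg r)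
    nlinarith
  linarith
end

section
/- Let A be a real m×n matrix in which every row A_i is nonzero, with Frobenius norm ‖A‖_F. Define M as the (mn)×m real matrix with entries M_{(i,j),i'} = δ_{i,i'} · A_{ij}/‖A_i‖ and N as the (mn)×n real matrix with entries N_{(i,j),j'} = δ_{j,j'} · ‖A_i‖/‖A‖_F, where (i,j) ranges over pairs in {1,...,m}×{1,...,n}. Then MᵀM = I_m, NᵀN = I_n, and MᵀN = A/‖A‖_F. -/
open Matrix

/-- the QSVE factorisation `A/‖A‖_F = MᵀN` with `MᵀM = I_m` and
`NᵀN = I_n`, where `M_{(i,j),i'} = δ_{i,i'} A_{ij}/‖A_i‖` and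
`N_{(i,j),j'} = δ_{j,j'} ‖A_i‖/‖A‖_F`. -/
theorem qsve_factorisation (m n : ℕ) (hm : 0 < m) (A : Matrix (Fin m) (Fin n) ℝ)
    (hrows : ∀ i, A i ≠ 0) :
    ∀ rowNorm : Fin m → ℝ, rowNorm = (fun i => Real.sqrt (∑ j, A i j ^ 2)) →
    ∀ frob : ℝ, frob = Real.sqrt (∑ i, ∑ j, A i j ^ 2) →
    ∀ M : Matrix (Fin m × Fin n) (Fin m) ℝ,
      M = Matrix.of (fun p i' => if p.1 = i' then A p.1 p.2 / rowNorm p.1 else 0) →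
    ∀ N : Matrix (Fin m × Fin n) (Fin n) ℝ,
      N = Matrix.of (fun p j' => if p.2 = j' then rowNorm p.1 / frob else 0) →
      Mᵀ * M = 1 ∧ Nᵀ * N = 1 ∧ Mᵀ * N = frob⁻¹ • A := by
  intro r hr f hf M hM N hN
  have hpos : ∀ i, 0 < ∑ j, A i j ^ 2 := by
    intro i
    obtain ⟨j, hj⟩ := Function.ne_iff.mp (hrows i)
    have hj' : A i j ≠ 0 := hj
    exact Finset.sum_pos' (fun k _ => sq_nonneg _) ⟨j, Finset.mem_univ j, by positivity⟩
  have hr0 : ∀ i, r i ≠ 0 := by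
    intro i
    rw [hr]
    exact (Real.sqrt_pos.mpr (hpos i)).ne'
  have hr2 : ∀ i, r i ^ 2 = ∑ j, A i j ^ 2 := by
    intro i
    rw [hr]
    exact Real.sq_sqrt (hpos i).le
  have hfpos : 0 < ∑ i, ∑ j, A i j ^ 2 :=
    Finset.sum_pos (fun i _ => hpos i) ⟨⟨0, hm⟩, Finset.mem_univ _⟩
  have hf0 : f ≠ 0 := by
    rw [hf]
    exact (Real.sqrt_pos.mpr hfpos).ne'
  have hf2 : f ^ 2 = ∑ i, r i ^ 2 := by
    simp only [hr2]
    rw [hf]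
    exact Real.sq_sqrt hfpos.le
  clear hr hf
  subst hM hN
  refine ⟨?_, ?_, ?_⟩
  · ext a b
    simp only [Matrix.mul_apply, Matrix.transpose_apply, Matrix.of_apply, Fintype.sum_prod_type,
      Matrix.one_apply]
    rw [Finset.sum_eq_single a (fun c _ hc => by simp [hc]) (by simp)]
    by_cases hab : a = b
    · subst hab
      simp only [if_true]
      have h : ∀ j, A a j / r a * (A a j / r a) = A a j ^ 2 / r a ^ 2 := fun j => by ring
      simp only [h]
      rw [← Finset.sum_div, ← hr2, div_self (pow_ne_zero 2 (hr0 a))]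
    · simp [hab]
  · ext a b
    simp only [Matrix.mul_apply, Matrix.transpose_apply, Matrix.of_apply, Fintype.sum_prod_type,
      Matrix.one_apply]
    rw [Finset.sum_comm, Finset.sum_eq_single a (fun c _ hc => by simp [hc]) (by simp)]
    by_cases hab : a = b
    · subst hab
      simp only [if_true]
      have h : ∀ i, r i / f * (r i / f) = r i ^ 2 / f ^ 2 := fun j => by ring
      simp only [h]
      rw [← Finset.sum_div, ← hf2, div_self (pow_ne_zero 2 hf0)]
    · simp [hab]
  · ext a b
    simp only [Matrix.mul_apply, Matrix.transpose_apply, Matrix.of_apply, Fintype.sum_prod_type,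
      Matrix.smul_apply, smul_eq_mul]
    rw [Finset.sum_eq_single a (fun c _ hc => by simp [hc]) (by simp),
      Finset.sum_eq_single b (fun c _ hc => by simp [hc]) (by simp)]
    simp only [if_true]
    have := hr0 a
    field_simp
end

section
/- Let n ≥ 1, N = 2^n, and let j ∈ {0, ..., N−1}. Then the quantum Fourier basis state f_j ∈ ℂ^N with amplitudes (f_j)_k = (1/√N)·exp(2πi j k / N) is a product state: under the identification of ℂ^N with the n-fold tensor product (ℂ²)^{⊗n} that sends the basis vector indexed by k = Σ_{l=1}^{n} k_l 2^{n−l} (with k_l ∈ {0,1}, k_1 most significant) to |k_1⟩ ⊗ ⋯ ⊗ |k_n⟩, one has f_j = ⊗_{l=1}^{n} (1/√2)·(|0⟩ + exp(2πi j / 2^l)·|1⟩). Equivalently, for all j, k ∈ {0,...,N−1}: (1/√N)·exp(2πi j k/N) = Π_{l=1}^{n} (1/√2)·exp(2πi j k_l / 2^l). -/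
open Complex Real

theorem qft_bits_sum (n : ℕ) : ∀ k : ℕ, k < 2 ^ n →
    ∑ l ∈ Finset.range n, ((k / 2 ^ (n - (l + 1)) % 2 : ℕ) : ℂ) / ((2 : ℂ) ^ (l + 1)) =
      (k : ℂ) / (2 : ℂ) ^ n := by
  induction n with
  | zero =>
    intro k hk
    have : k = 0 := by simpa using hk
    simp [this]
  | succ n ih =>
    intro k hk
    have h2 : k / 2 < 2 ^ n := by rw [pow_succ] at hk; omega
    rw [Finset.sum_range_succ]
    have hs : ∑ l ∈ Finset.range n,
        ((k / 2 ^ (n + 1 - (l + 1)) % 2 : ℕ) : ℂ) / ((2 : ℂ) ^ (l + 1)) =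
        ((k / 2 : ℕ) : ℂ) / (2 : ℂ) ^ n := by
      rw [← ih (k / 2) h2]
      refine Finset.sum_congr rfl fun l hl => ?_
      have hl' : l < n := Finset.mem_range.mp hl
      have e : n + 1 - (l + 1) = (n - (l + 1)) + 1 := by omega
      rw [e, pow_succ', ← Nat.div_div_eq_div_mul]
    rw [hs]
    have hk2 : (k : ℂ) = 2 * ((k / 2 : ℕ) : ℂ) + ((k % 2 : ℕ) : ℂ) := by
      exact_mod_cast (Nat.div_add_mod k 2).symm
    simp only [Nat.sub_self, pow_zero, Nat.div_one]
    rw [hk2, pow_succ]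
    field_simp

/-- the quantum Fourier basis state is a product state.  Stated as the
equivalent amplitude identity: for `N = 2^n` and `j, k < N`, writing
`k_l = ⌊k/2^{n−l}⌋ mod 2` for the `l`-th (most-significant-first) bit of `k`,
`(1/√N)·e^{2πi jk/N} = Π_{l=1}^{n} (1/√2)·e^{2πi j k_l/2^l}`, which expresses that
`f_j = ⊗_{l=1}^n (1/√2)(|0⟩ + e^{2πi j/2^l}|1⟩)` under the binary tensor-product
identification of `ℂ^N` with `(ℂ²)^{⊗n}`. -/
theorem qft_product_state (n : ℕ) (hn : 1 ≤ n) (j k : ℕ)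
    (hj : j < 2 ^ n) (hk : k < 2 ^ n) :
    (1 / (Real.sqrt (2 ^ n) : ℂ)) *
        Complex.exp (2 * (Real.pi : ℂ) * Complex.I * (j : ℂ) * (k : ℂ) / ((2 : ℂ) ^ n)) =
      ∏ l ∈ Finset.range n,
        (1 / (Real.sqrt 2 : ℂ)) *
          Complex.exp (2 * (Real.pi : ℂ) * Complex.I * (j : ℂ) *
            ((k / 2 ^ (n - (l + 1)) % 2 : ℕ) : ℂ) / ((2 : ℂ) ^ (l + 1))) := by
  rw [Finset.prod_mul_distrib, ← Complex.exp_sum, Finset.prod_const, Finset.card_range]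
  congr 1
  · have h : Real.sqrt (2 ^ n) = Real.sqrt 2 ^ n := by
      rw [Real.sqrt_eq_iff_mul_self_eq (by positivity) (by positivity), ← mul_pow,
        Real.mul_self_sqrt (by norm_num)]
    rw [h, div_pow, one_pow, Complex.ofReal_pow]
  · rw [mul_div_assoc, ← qft_bits_sum n k hk, Finset.mul_sum]
    simp only [mul_div_assoc]
end

section
/- Let N ≥ 2 be an integer, let a ∈ {1,...,N}, let ψ_0 ∈ ℝ^N be the uniform superposition ψ_0 = (1/√N)·(1,...,1), let e_a be the a-th standard basis vector, and define Z := I − 2 e_a e_aᵀ, D := 2 ψ_0 ψ_0ᵀ − I, and the Grover operator G := D Z. Let θ := arcsin(1/√N). Then for every integer k ≥ 0, ⟨e_a, G^k ψ_0⟩ = sin((2k+1)θ); in particular the probability of observing the marked item after k Grover iterations is sin²((2k+1)θ). -/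
open Matrix

/-- Grover's algorithm with a unique marked item `a` out of `N`.
With `ψ₀` the uniform superposition, `Z = I − 2e_a e_aᵀ`, `D = 2ψ₀ψ₀ᵀ − I`,
`G = D·Z` and `θ = arcsin(1/√N)`, for every `k ≥ 0` the overlap of `G^k ψ₀` with
the marked basis vector satisfies `⟨e_a, G^k ψ₀⟩ = sin((2k+1)θ)`; in particular the
success probability after `k` iterations is `sin²((2k+1)θ)`. -/
theorem grover_amplitude (N : ℕ) (hN : 2 ≤ N) (a : Fin N) :
    ∀ ψ₀ : Fin N → ℝ, ψ₀ = (fun _ => 1 / Real.sqrt N) →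
    ∀ Z : Matrix (Fin N) (Fin N) ℝ,
      Z = 1 - (2 : ℝ) • Matrix.vecMulVec (Pi.single a 1) (Pi.single a 1) →
    ∀ D : Matrix (Fin N) (Fin N) ℝ,
      D = (2 : ℝ) • Matrix.vecMulVec ψ₀ ψ₀ - 1 →
    ∀ k : ℕ,
      ((D * Z) ^ k).mulVec ψ₀ a =
        Real.sin ((2 * (k : ℝ) + 1) * Real.arcsin (1 / Real.sqrt N)) ∧
      (((D * Z) ^ k).mulVec ψ₀ a) ^ 2 =
        Real.sin ((2 * (k : ℝ) + 1) * Real.arcsin (1 / Real.sqrt N)) ^ 2 := by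
  intro ψ₀ hψ Z hZ D hD
  set s : ℝ := 1 / Real.sqrt N with hs
  set θ : ℝ := Real.arcsin s with hθ
  have hN0 : (0 : ℝ) < N := by
    have : 0 < N := by omega
    exact_mod_cast this
  have hN1 : (1 : ℝ) ≤ N := by
    have : 1 ≤ N := by omega
    exact_mod_cast this
  have hs0 : 0 ≤ s := by positivity
  have hs2 : (N : ℝ) * s ^ 2 = 1 := by
    rw [hs, div_pow, Real.sq_sqrt hN0.le]
    field_simp
  have hs1 : s ≤ 1 := by nlinarith
  have hsin : Real.sin θ = s := Real.sin_arcsin (by linarith) hs1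
  have hnorm : ψ₀ ⬝ᵥ ψ₀ = 1 := by
    rw [hψ]
    simp only [dotProduct, Finset.sum_const, Finset.card_univ, Fintype.card_fin, nsmul_eq_mul]
    linarith
  have ha : ψ₀ a = s := by rw [hψ]
  have hstep : ∀ v : Fin N → ℝ, (D * Z).mulVec v =
      (2 * (ψ₀ ⬝ᵥ v - 2 * v a * s)) • ψ₀ - v + (2 * v a) • (Pi.single a (1 : ℝ)) := by
    intro v
    have h1 : Z.mulVec v = v - (2 * v a) • (Pi.single a (1 : ℝ)) := by
      rw [hZ, Matrix.sub_mulVec, Matrix.one_mulVec, Matrix.smul_mulVec, Matrix.vecMulVec_mulVec]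
      ext i
      simp
      ring
    rw [← Matrix.mulVec_mulVec, h1, hD, Matrix.sub_mulVec, Matrix.one_mulVec,
      Matrix.smul_mulVec, Matrix.vecMulVec_mulVec, dotProduct_sub, dotProduct_smul,
      dotProduct_single, ha]
    ext i
    simp
    ring
  have key : ∀ k : ℕ, ((D * Z) ^ k).mulVec ψ₀ a = Real.sin ((2 * (k : ℝ) + 1) * θ) ∧
      ψ₀ ⬝ᵥ ((D * Z) ^ k).mulVec ψ₀ = Real.cos ((2 * (k : ℝ) + 1) * θ - θ) := by
    intro k
    induction k with
    | zero => simp [ha, hnorm, hsin]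
    | succ k ih =>
      obtain ⟨h1, h2⟩ := ih
      rw [pow_succ', ← Matrix.mulVec_mulVec, hstep]
      set v := ((D * Z) ^ k).mulVec ψ₀
      set x := (2 * (k : ℝ) + 1) * θ with hx
      have hx' : (2 * ((k + 1 : ℕ) : ℝ) + 1) * θ = (x + θ) + θ := by
        rw [hx]; push_cast; ring
      have hsq := Real.sin_sq_add_cos_sq θ
      rw [hx', add_sub_cancel_right, h2, h1, dotProduct_add, dotProduct_sub, dotProduct_smul,
        dotProduct_smul, dotProduct_single, hnorm, h2, ha, ← hsin]
      constructor
      · simp only [Pi.add_apply, Pi.sub_apply, Pi.smul_apply, smul_eq_mul, Pi.single_eq_same,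
          ha, h1, ← hsin]
        rw [Real.sin_add (x + θ), Real.sin_add, Real.cos_add, Real.cos_sub]
        linear_combination (-Real.sin x) * hsq
      · simp only [smul_eq_mul]
        rw [Real.cos_add, Real.cos_sub]
        ring
  intro k
  exact ⟨(key k).1, by rw [(key k).1]⟩
end
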